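/- arXiv:gr-qc/0403033 — 3 statements merged into one kernel-verified Lean document; each statement's English description precedes it below -/
import Mathlib

section
/- Fix v and let u₀ < u₁. Suppose that on the segment [u₀,u₁] × {v} the functions r, Ω, φ are C¹ in u with r > 0 and Ω > 0, that u ↦ Ω⁻²(u,v) ∂_u r(u,v) is differentiable and equation (C1) holds pointwise on the segment, and that ν(u₀,v) = ∂_u r(u₀,v) < 0. Then ν(u,v) < 0 for every u ∈ [u₀,u₁]. -/
open Real Set MeasureTheory

/-- Partial derivative in the first (u) variable. -/
noncomputable def pu (f : ℝ → ℝ → ℝ) (u v : ℝ) : ℝ := deriv (fun x => f x v) u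

/-- Partial derivative in the second (v) variable. -/
noncomputable def pv (f : ℝ → ℝ → ℝ) (u v : ℝ) : ℝ := deriv (fun y => f u y) v

/-- The Hawking mass m = (r/2)(1 + 4 Ω⁻² ν λ). -/
noncomputable def hawkingMass (r Ω : ℝ → ℝ → ℝ) (u v : ℝ) : ℝ :=
  r u v / 2 * (1 + 4 * pu r u v * pv r u v / (Ω u v) ^ 2)

/-- κ = -Ω²/(4ν). -/
noncomputable def kappa (r Ω : ℝ → ℝ → ℝ) (u v : ℝ) : ℝ :=
  -(Ω u v) ^ 2 / (4 * pu r u v)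

/-- (E1):  ∂_u∂_v r = -(1/r)∂_u r ∂_v r - Ω²/(4r) + (r/2)Ω² V(φ). -/
def eqE1 (r Ω φ : ℝ → ℝ → ℝ) (V : ℝ → ℝ) (u v : ℝ) : Prop :=
  pu (pv r) u v =
    -(1 / r u v) * pu r u v * pv r u v - (Ω u v) ^ 2 / (4 * r u v)
      + r u v / 2 * (Ω u v) ^ 2 * V (φ u v)

/-- (E2):  ∂_u∂_v log Ω² = Ω²/(4r²) + r⁻²∂_u r ∂_v r - ∂_u φ ∂_v φ. -/
def eqE2 (r Ω φ : ℝ → ℝ → ℝ) (u v : ℝ) : Prop :=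
  pu (pv (fun a b => Real.log ((Ω a b) ^ 2))) u v =
    (Ω u v) ^ 2 / (4 * (r u v) ^ 2) + pu r u v * pv r u v / (r u v) ^ 2
      - pu φ u v * pv φ u v

/-- (E3):  ∂_u∂_v φ = -r⁻¹∂_u φ ∂_v r - r⁻¹∂_v φ ∂_u r - (Ω²/4)V'(φ). -/
def eqE3 (r Ω φ : ℝ → ℝ → ℝ) (V : ℝ → ℝ) (u v : ℝ) : Prop :=
  pu (pv φ) u v =
    -(pu φ u v * pv r u v) / r u v - (pv φ u v * pu r u v) / r u v
      - (Ω u v) ^ 2 / 4 * deriv V (φ u v)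

/-- (C1):  ∂_u(Ω⁻²∂_u r) = -rΩ⁻²(∂_u φ)². -/
def eqC1 (r Ω φ : ℝ → ℝ → ℝ) (u v : ℝ) : Prop :=
  pu (fun a b => pu r a b / (Ω a b) ^ 2) u v =
    -(r u v) * (pu φ u v) ^ 2 / (Ω u v) ^ 2

/-- (C2):  ∂_v(Ω⁻²∂_v r) = -rΩ⁻²(∂_v φ)². -/
def eqC2 (r Ω φ : ℝ → ℝ → ℝ) (u v : ℝ) : Prop :=
  pv (fun a b => pv r a b / (Ω a b) ^ 2) u v =
    -(r u v) * (pv φ u v) ^ 2 / (Ω u v) ^ 2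

/-- if (C1) holds along the segment [u₀,u₁] × {v} and ν(u₀,v) < 0,
then ν < 0 on the whole segment. -/
theorem nu_neg_propagates (r Ω φ : ℝ → ℝ → ℝ) (v u₀ u₁ : ℝ) (hu : u₀ < u₁)
    (hr : ContDiffOn ℝ 1 (fun u => r u v) (Set.Icc u₀ u₁))
    (hΩ : ContDiffOn ℝ 1 (fun u => Ω u v) (Set.Icc u₀ u₁))
    (hφ : ContDiffOn ℝ 1 (fun u => φ u v) (Set.Icc u₀ u₁))
    (hrpos : ∀ u ∈ Set.Icc u₀ u₁, 0 < r u v)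
    (hΩpos : ∀ u ∈ Set.Icc u₀ u₁, 0 < Ω u v)
    (hdiff : ∀ u ∈ Set.Icc u₀ u₁,
      DifferentiableAt ℝ (fun x => pu r x v / (Ω x v) ^ 2) u)
    (hC1 : ∀ u ∈ Set.Icc u₀ u₁, eqC1 r Ω φ u v)
    (hν₀ : pu r u₀ v < 0) :
    ∀ u ∈ Set.Icc u₀ u₁, pu r u v < 0 := by
  intro u hmem
  have hanti : AntitoneOn (fun x => pu r x v / (Ω x v) ^ 2) (Set.Icc u₀ u₁) := by
    refine antitoneOn_of_deriv_nonpos (convex_Icc u₀ u₁)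
      (fun x hx => (hdiff x hx).continuousAt.continuousWithinAt)
      (fun x hx => (hdiff x (interior_subset hx)).differentiableWithinAt) fun x hx => ?_
    have hx' := interior_subset hx
    have h := hC1 x hx'
    unfold eqC1 at h
    rw [show deriv (fun x => pu r x v / (Ω x v) ^ 2) x = _ from h, neg_mul, neg_div]
    have := hrpos x hx'
    exact neg_nonpos.mpr (by positivity)
  have hu₀ : u₀ ∈ Set.Icc u₀ u₁ := Set.left_mem_Icc.mpr hu.le
  have hneg : pu r u v / (Ω u v) ^ 2 < 0 :=
    (hanti hu₀ hmem hmem.1).trans_lt (div_neg_of_neg_of_pos hν₀ (pow_pos (hΩpos u₀ hu₀) 2))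
  simpa using (div_lt_iff₀ (pow_pos (hΩpos u hmem) 2)).mp hneg
end

section
/- Fix u and let v₀ < v̄. Suppose that on the segment {u} × [v₀,v̄] the functions r, Ω, φ are C¹ in v with r > 0 and Ω > 0, that v ↦ Ω⁻²(u,v) ∂_v r(u,v) is differentiable and equation (C2) holds pointwise, and that λ(u,v₀) ≤ 0. Then r(u,v) ≤ r(u,v₀) for every v ∈ [v₀,v̄]. Consequently, if r is unbounded above on the ray {u} × [v₀,∞) (on which the above hypotheses hold on every compact subsegment), then λ(u,v₀) > 0. -/
open Real Set MeasureTheory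

/-- Hypotheses of STATEMENT 4 on the segment {u} × [a,b]:  r, Ω, φ are C¹ in v,
r > 0, Ω > 0, v ↦ Ω⁻²∂_v r is differentiable, and (C2) holds pointwise. -/
def Stmt4Hyp (r Ω φ : ℝ → ℝ → ℝ) (u a b : ℝ) : Prop :=
  ContDiffOn ℝ 1 (fun v => r u v) (Set.Icc a b) ∧
  ContDiffOn ℝ 1 (fun v => Ω u v) (Set.Icc a b) ∧
  ContDiffOn ℝ 1 (fun v => φ u v) (Set.Icc a b) ∧
  ∀ v ∈ Set.Icc a b, 0 < r u v ∧ 0 < Ω u v ∧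
    DifferentiableAt ℝ (fun y => pv r u y / (Ω u y) ^ 2) v ∧ eqC2 r Ω φ u v

/-- Under (C2) the quantity `Ω⁻² ∂_v r` is nonincreasing, so `∂_v r` stays nonpositive. -/
theorem pv_nonpos_of_stmt4Hyp {r Ω φ : ℝ → ℝ → ℝ} {u a b : ℝ} (h : Stmt4Hyp r Ω φ u a b)
    (ha : pv r u a ≤ 0) {v : ℝ} (hv : v ∈ Set.Icc a b) : pv r u v ≤ 0 := by
  obtain ⟨-, -, -, H⟩ := h
  have hanti : AntitoneOn (fun y => pv r u y / (Ω u y) ^ 2) (Set.Icc a b) := by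
    apply antitoneOn_of_deriv_nonpos (convex_Icc a b)
    · exact fun x hx => (H x hx).2.2.1.continuousAt.continuousWithinAt
    · exact fun x hx => (H x (interior_subset hx)).2.2.1.differentiableWithinAt
    · intro x hx
      obtain ⟨hr, -, -, hC2⟩ := H x (interior_subset hx)
      have hC2' : deriv (fun y => pv r u y / (Ω u y) ^ 2) x =
          -(r u x) * (pv φ u x) ^ 2 / (Ω u x) ^ 2 := hC2
      rw [hC2', neg_mul, neg_div]
      exact neg_nonpos.mpr (by positivity)
  have hle : pv r u v / (Ω u v) ^ 2 ≤ pv r u a / (Ω u a) ^ 2 :=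
    hanti (Set.left_mem_Icc.mpr (hv.1.trans hv.2)) hv hv.1
  have hpos : 0 < (Ω u v) ^ 2 := pow_pos (H v hv).2.1 2
  have hquot := hle.trans (div_nonpos_of_nonpos_of_nonneg ha (sq_nonneg (Ω u a)))
  simpa using (div_le_iff₀ hpos).mp hquot

/-- If `∂_v r ≤ 0` at the initial point, then `r` is bounded by its initial value. -/
theorem r_le_of_stmt4Hyp {r Ω φ : ℝ → ℝ → ℝ} {u a b : ℝ} (h : Stmt4Hyp r Ω φ u a b)
    (ha : pv r u a ≤ 0) {v : ℝ} (hv : v ∈ Set.Icc a b) : r u v ≤ r u a := by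
  have hanti : AntitoneOn (fun y => r u y) (Set.Icc a b) :=
    antitoneOn_of_deriv_nonpos (convex_Icc a b) h.1.continuousOn
      ((h.1.differentiableOn one_ne_zero).mono interior_subset)
      fun x hx => pv_nonpos_of_stmt4Hyp h ha (interior_subset hx)
  exact hanti (Set.left_mem_Icc.mpr (hv.1.trans hv.2)) hv hv.1

/-- if λ(u,v₀) ≤ 0 then r(u,·) ≤ r(u,v₀) on [v₀,v̄]; consequently if r is
unbounded above on the ray {u} × [v₀,∞) (with the hypotheses holding on every compact
subsegment) then λ(u,v₀) > 0. -/
theorem r_bounded_of_lambda_nonpos (r Ω φ : ℝ → ℝ → ℝ) (u v₀ : ℝ) :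
    (∀ vb, v₀ < vb → Stmt4Hyp r Ω φ u v₀ vb → pv r u v₀ ≤ 0 →
      ∀ v ∈ Set.Icc v₀ vb, r u v ≤ r u v₀) ∧
    ((∀ vb, v₀ < vb → Stmt4Hyp r Ω φ u v₀ vb) →
      ¬ BddAbove ((fun v => r u v) '' Set.Ici v₀) → 0 < pv r u v₀) := by
  refine ⟨fun vb _ h h0 v hv => r_le_of_stmt4Hyp h h0 hv, fun h hunb => ?_⟩
  by_contra! h0
  refine hunb ⟨r u v₀, ?_⟩
  rintro _ ⟨v, hv, rfl⟩
  exact r_le_of_stmt4Hyp (h (v + 1) (lt_add_of_le_of_pos hv one_pos)) h0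
    ⟨hv, (lt_add_one v).le⟩
end

section
/- Suppose at a point (u,v) the functions r, Ω, φ are C² with r > 0, Ω > 0 and ν = ∂_u r < 0, and that equations (E1) and (C2) hold at (u,v). Then the Hawking mass m = (r/2)(1 + 4Ω⁻² ν λ) satisfies at (u,v): ∂_v m = (1/2) κ⁻¹ θ² + r² V(φ) λ, where κ = -Ω²/(4ν) and θ = r ∂_v φ. -/
open Real Set MeasureTheory

open Filter Topology

theorem pu_eventuallyEq_fderiv {f : ℝ → ℝ → ℝ} {p : ℝ × ℝ}
    (hf : ContDiffAt ℝ 1 (fun q : ℝ × ℝ => f q.1 q.2) p) :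
    (fun q : ℝ × ℝ => pu f q.1 q.2) =ᶠ[𝓝 p]
      fun q => fderiv ℝ (fun q : ℝ × ℝ => f q.1 q.2) q (1, 0) := by
  filter_upwards [hf.eventually (by simp)] with q hq
  exact ((hq.differentiableAt one_ne_zero).hasFDerivAt.comp_hasDerivAt (f := fun x => (x, q.2)) q.1
    ((hasDerivAt_id q.1).prodMk (hasDerivAt_const q.1 q.2))).deriv

theorem pv_eventuallyEq_fderiv {f : ℝ → ℝ → ℝ} {p : ℝ × ℝ}
    (hf : ContDiffAt ℝ 1 (fun q : ℝ × ℝ => f q.1 q.2) p) :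
    (fun q : ℝ × ℝ => pv f q.1 q.2) =ᶠ[𝓝 p]
      fun q => fderiv ℝ (fun q : ℝ × ℝ => f q.1 q.2) q (0, 1) := by
  filter_upwards [hf.eventually (by simp)] with q hq
  exact ((hq.differentiableAt one_ne_zero).hasFDerivAt.comp_hasDerivAt (f := fun y => (q.1, y)) q.2
    ((hasDerivAt_const q.2 q.1).prodMk (hasDerivAt_id q.2))).deriv

theorem contDiffAt_pu {f : ℝ → ℝ → ℝ} {p : ℝ × ℝ}
    (hf : ContDiffAt ℝ 2 (fun q : ℝ × ℝ => f q.1 q.2) p) :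
    ContDiffAt ℝ 1 (fun q : ℝ × ℝ => pu f q.1 q.2) p :=
  ((hf.fderiv_right (m := 1) (by norm_num)).clm_apply contDiffAt_const).congr_of_eventuallyEq
    (pu_eventuallyEq_fderiv (hf.of_le (by norm_num)))

theorem contDiffAt_pv {f : ℝ → ℝ → ℝ} {p : ℝ × ℝ}
    (hf : ContDiffAt ℝ 2 (fun q : ℝ × ℝ => f q.1 q.2) p) :
    ContDiffAt ℝ 1 (fun q : ℝ × ℝ => pv f q.1 q.2) p :=
  ((hf.fderiv_right (m := 1) (by norm_num)).clm_apply contDiffAt_const).congr_of_eventuallyEq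
    (pv_eventuallyEq_fderiv (hf.of_le (by norm_num)))

theorem hasDerivAt_pv {f : ℝ → ℝ → ℝ} {u v : ℝ}
    (hf : ContDiffAt ℝ 1 (fun q : ℝ × ℝ => f q.1 q.2) (u, v)) :
    HasDerivAt (fun y => f u y) (pv f u v) v :=
  ((hf.differentiableAt one_ne_zero).comp (f := fun y => (u, y)) v
    (by fun_prop)).hasDerivAt

/-- Mixed partial derivatives of a C² function commute. -/
theorem pv_pu_eq_pu_pv {f : ℝ → ℝ → ℝ} {u v : ℝ}
    (hf : ContDiffAt ℝ 2 (fun q : ℝ × ℝ => f q.1 q.2) (u, v)) :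
    pv (pu f) u v = pu (pv f) u v := by
  have hf₁ : ContDiffAt ℝ 1 (fun q : ℝ × ℝ => f q.1 q.2) (u, v) := hf.of_le (by norm_num)
  have hd : HasFDerivAt (fderiv ℝ (fun q : ℝ × ℝ => f q.1 q.2)) _ (u, v) :=
    ((hf.fderiv_right (m := 1) (by norm_num)).differentiableAt one_ne_zero).hasFDerivAt
  have hvu : pv (pu f) u v = fderiv ℝ (fun q : ℝ × ℝ => pu f q.1 q.2) (u, v) (0, 1) :=
    (pv_eventuallyEq_fderiv (contDiffAt_pu hf)).self_of_nhds
  have huv : pu (pv f) u v = fderiv ℝ (fun q : ℝ × ℝ => pv f q.1 q.2) (u, v) (1, 0) :=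
    (pu_eventuallyEq_fderiv (contDiffAt_pv hf)).self_of_nhds
  rw [(pu_eventuallyEq_fderiv hf₁).fderiv_eq,
    (hd.clm_apply (hasFDerivAt_const (1, 0) _)).fderiv] at hvu
  rw [(pv_eventuallyEq_fderiv hf₁).fderiv_eq,
    (hd.clm_apply (hasFDerivAt_const (0, 1) _)).fderiv] at huv
  have hsymm := (hf.isSymmSndFDerivAt (by simp)) (0, 1) (1, 0)
  simp only [ContinuousLinearMap.comp_zero, zero_add, ContinuousLinearMap.flip_apply] at hvu huv
  rw [hvu, huv, hsymm]

/-- the identity ∂_v m = (1/2)κ⁻¹θ² + r²V(φ)λ. -/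
theorem dv_hawkingMass (r Ω φ : ℝ → ℝ → ℝ) (V : ℝ → ℝ) (u v : ℝ)
    (hV : ContDiff ℝ 1 V)
    (hr : ContDiffAt ℝ 2 (fun p : ℝ × ℝ => r p.1 p.2) (u, v))
    (hΩ : ContDiffAt ℝ 2 (fun p : ℝ × ℝ => Ω p.1 p.2) (u, v))
    (hφ : ContDiffAt ℝ 2 (fun p : ℝ × ℝ => φ p.1 p.2) (u, v))
    (hrpos : 0 < r u v) (hΩpos : 0 < Ω u v) (hν : pu r u v < 0)
    (hE1 : eqE1 r Ω φ V u v) (hC2 : eqC2 r Ω φ u v) :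
    pv (hawkingMass r Ω) u v =
      1 / 2 * (kappa r Ω u v)⁻¹ * (r u v * pv φ u v) ^ 2
        + (r u v) ^ 2 * V (φ u v) * pv r u v := by
  have hr₁ : ContDiffAt ℝ 1 (fun p : ℝ × ℝ => r p.1 p.2) (u, v) := hr.of_le (by norm_num)
  have hΩ₁ : ContDiffAt ℝ 1 (fun p : ℝ × ℝ => Ω p.1 p.2) (u, v) := hΩ.of_le (by norm_num)
  have hquot := hasDerivAt_pv (f := fun a b => pv r a b / Ω a b ^ 2)
    ((contDiffAt_pv hr).div (hΩ₁.pow 2) (by positivity))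
  have hmass := ((hasDerivAt_pv hr₁).div_const 2).mul
    ((((hasDerivAt_pv (contDiffAt_pu hr)).const_mul 4).mul hquot).const_add 1)
  have hfun : (fun y => hawkingMass r Ω u y) =
      (fun y => r u y / 2) * fun y => 1 + 4 * pu r u y * (pv r u y / Ω u y ^ 2) := by
    funext y
    simp [hawkingMass, mul_div_assoc]
  have hm : pv (hawkingMass r Ω) u v = _ := (congrArg (deriv · v) hfun).trans hmass.deriv
  unfold eqC2 at hC2
  unfold eqE1 at hE1
  rw [hm, hC2, pv_pu_eq_pu_pv hr, hE1, kappa]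
  have hν₀ := hν.ne
  simp only [Pi.mul_apply]
  field_simp
  ring
end
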